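/- In the example instance, there exists a constant c > 0 such that every rate tuple (R₁, R₂, R₃, R₄) ∈ ℛ_a satisfies R₁ + R₂ + R₃ ≥ c. In particular, for every r ∈ ℝ, the rate tuple (0, 0, 0, r) does not belong to ℛ_a. -/

import Mathlib

open scoped Classical

noncomputable section

/-- A probability mass function on a finite type: nonnegative and summing to one. -/
def IsPMF {α : Type*} [Fintype α] (p : α → ℝ) : Prop :=
  (∀ x, 0 ≤ p x) ∧ ∑ x, p x = 1

/-- Shannon entropy in bits, with the convention `0 · log₂ 0 = 0`. -/
def Ent {α : Type*} [Fintype α] (p : α → ℝ) : ℝ :=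
  -∑ x, p x * Real.logb 2 (p x)

/-- Pushforward of a mass function along a map. -/
def push {α β : Type*} [Fintype α] (f : α → β) (p : α → ℝ) : β → ℝ :=
  fun b => ∑ a ∈ Finset.univ.filter (fun a => f a = b), p a

/-- Tuples indexed by a finite subset `A` of the coordinates. -/
abbrev Vec {N : ℕ} (X : Fin N → Type) (A : Finset (Fin N)) : Type :=
  ∀ i : {i // i ∈ A}, X i.1

section

variable {N : ℕ} {X : Fin N → Type} [∀ i, Fintype (X i)]

/-- Restriction of a tuple on coordinates `A` to a smaller subset `B ⊆ A`. -/
def restr {A B : Finset (Fin N)} (h : B ⊆ A) (x : Vec X A) : Vec X B :=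
  fun i => x ⟨i.1, h i.2⟩

/-- Marginal of a mass function on coordinates `A` onto `B ⊆ A`. -/
def marg {A B : Finset (Fin N)} (p : Vec X A → ℝ) (h : B ⊆ A) : Vec X B → ℝ :=
  push (restr h) p

/-- Marginal of a mass function on all coordinates onto the subset `A`. -/
def margF (p : (∀ i, X i) → ℝ) (A : Finset (Fin N)) : Vec X A → ℝ :=
  push (fun x i => x i.1) p

/-- Single-coordinate marginal. -/
def margOne (p : (∀ i, X i) → ℝ) (i : Fin N) : X i → ℝ :=
  push (fun x => x i) p

variable {M : ℕ}

/-- The prescribed subset distributions are PMFs, consistent with each other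
(marginals agree on intersections) and with the single-coordinate marginals `P i`. -/
def Consistent (P : ∀ i, X i → ℝ) (S : Fin M → Finset (Fin N))
    (PS : ∀ j, Vec X (S j) → ℝ) : Prop :=
  (∀ i, IsPMF (P i)) ∧ (∀ j, IsPMF (PS j)) ∧
  (∀ j j', marg (PS j) (Finset.inter_subset_left : S j ∩ S j' ⊆ S j)
         = marg (PS j') (Finset.inter_subset_right : S j ∩ S j' ⊆ S j')) ∧
  (∀ j, ∀ i, ∀ h : i ∈ S j, push (fun x : Vec X (S j) => x ⟨i, h⟩) (PS j) = P i)

/-- The constrained maximum entropy `H*(𝒥)`: the supremum of entropies of PMFs on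
`∏_{i ∈ 𝒥} 𝒳_i` whose marginal on `𝒥 ∩ 𝒮_j` equals the marginal of `P_{𝒮_j}` for every `j`. -/
def Hstar (S : Fin M → Finset (Fin N)) (PS : ∀ j, Vec X (S j) → ℝ)
    (J : Finset (Fin N)) : ℝ :=
  sSup { h | ∃ q : Vec X J → ℝ, IsPMF q ∧
    (∀ j, marg q (Finset.inter_subset_left : J ∩ S j ⊆ J)
        = marg (PS j) (Finset.inter_subset_right : J ∩ S j ⊆ S j)) ∧
    h = Ent q }

end

/-- `ε`-typicality of a length-`n` sequence for a PMF `Q`. -/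
def Typical {α : Type*} [Fintype α] (n : ℕ) (ε : ℝ) (Q : α → ℝ) (x : Fin n → α) : Prop :=
  ∀ a, |((Finset.univ.filter (fun l => x l = a)).card : ℝ) / n - Q a| ≤ ε * Q a

/-- Joint `ε`-typicality, for the tuple of sequences restricted to the subset `A`,
of the induced sequence over the product alphabet. -/
def SubTyp {N : ℕ} {X : Fin N → Type} [∀ i, Fintype (X i)] (n : ℕ) (ε : ℝ)
    {A : Finset (Fin N)} (Q : Vec X A → ℝ) (x : ∀ i, Fin n → X i) : Prop :=
  Typical n ε Q (fun l (i : {i // i ∈ A}) => x i.1 l)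

/-- Probability of the event `E` when the `N` sequences of length `n` are generated
mutually independently, coordinatewise i.i.d. according to the marginals `P i`. -/
def probIID {N : ℕ} {X : Fin N → Type} [∀ i, Fintype (X i)] (P : ∀ i, X i → ℝ) (n : ℕ)
    (E : (∀ i, Fin n → X i) → Prop) : ℝ :=
  ∑ x ∈ Finset.univ.filter E, ∏ i, ∏ l, P i (x i l)

/-- `δ` is a valid correction function: positive on positive arguments and
vanishing as `ε → 0⁺`. -/
def DeltaFun (δ : ℝ → ℝ) : Prop :=
  (∀ ε, 0 < ε → 0 < δ ε) ∧ Filter.Tendsto δ (nhdsWithin 0 (Set.Ioi 0)) (nhds 0)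

end
noncomputable section

/-- The rate region `ℛ_a`: the closed convex hull of rate tuples achievable with a single
joint distribution consistent with all the prescribed subset distributions. -/
def Ra {N M : ℕ} {X : Fin N → Type} [∀ i, Fintype (X i)] (P : ∀ i, X i → ℝ)
    (S : Fin M → Finset (Fin N)) (PS : ∀ j, Vec X (S j) → ℝ) : Set (Fin N → ℝ) :=
  closure (convexHull ℝ
    { R | ∃ p : (∀ i, X i) → ℝ, IsPMF p ∧ (∀ j, margF p (S j) = PS j) ∧
        ∀ J : Finset (Fin N), J.Nonempty →
          ∑ i ∈ J, R i ≥ (∑ i ∈ J, Ent (P i)) - Ent (margF p J) })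

/-- The rate region `ℛ_a*` given by the constrained maximum entropy functionals. -/
def RaStar {N M : ℕ} {X : Fin N → Type} [∀ i, Fintype (X i)] (P : ∀ i, X i → ℝ)
    (S : Fin M → Finset (Fin N)) (PS : ∀ j, Vec X (S j) → ℝ) : Set (Fin N → ℝ) :=
  { R | ∀ J : Finset (Fin N), J.Nonempty →
      ∑ i ∈ J, R i ≥ (∑ i ∈ J, Ent (P i)) - Hstar S PS J }

end
noncomputable section

/-- The six two-element constraint subsets of the example instance
(coordinates `0,1,2,3` standing for `X₁,X₂,X₃,X₄`). -/
def Spairs : Fin 6 → Finset (Fin 4) := ![{0, 1}, {0, 2}, {1, 2}, {0, 3}, {1, 3}, {2, 3}]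

/-- The marginal PMFs of the example: `X₁,X₂,X₃ ~ bern(1/2)`, `X₄ ~ bern(3/4)`
(with `false` standing for `0`). -/
def Pex : ∀ _ : Fin 4, Bool → ℝ :=
  fun i b => if i.1 < 3 then 1 / 2 else if b = false then 3 / 4 else 1 / 4

/-- The prescribed pairwise PMF of `(Xᵢ, X₄)`: mass `1/2` at `(0,0)`, `0` at `(0,1)`,
`1/4` at `(1,0)` and `1/4` at `(1,1)`. -/
def pair14 : Bool → Bool → ℝ :=
  fun a b => if a = false then (if b = false then 1 / 2 else 0) else 1 / 4

/-- Value of a tuple `y` on subset `A` at a coordinate `i` (junk value `false` if `i ∉ A`). -/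
def getB {A : Finset (Fin 4)} (y : Vec (fun _ : Fin 4 => Bool) A) (i : Fin 4) : Bool :=
  if h : i ∈ A then y ⟨i, h⟩ else false

/-- The prescribed pairwise distributions of the example instance: `(Xᵢ, Xⱼ)` is uniform on
`{0,1}²` for `i < j` in `{1,2,3}`, and `(Xᵢ, X₄)` is distributed according to `pair14`. -/
def PSex (j : Fin 6) : Vec (fun _ : Fin 4 => Bool) (Spairs j) → ℝ :=
  fun y =>
    if j.1 < 3 then 1 / 4
    else pair14 (getB y ⟨j.1 - 3, by have := j.isLt; omega⟩) (getB y 3)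

/-- Binary entropy function (in bits). -/
def Hb (p : ℝ) : ℝ := -(p * Real.logb 2 p) - (1 - p) * Real.logb 2 (1 - p)

end
lemma margF_comp_val (p : (Fin 4 → Bool) → ℝ) (A : Finset (Fin 4)) (z : Fin 4 → Bool) :
    margF (X := fun _ => Bool) p A (fun i => z i.1) =
      ∑ x : Fin 4 → Bool, if ∀ i ∈ A, x i = z i then p x else 0 := by
  simp only [margF, push, Finset.sum_filter, funext_iff, Subtype.forall]

lemma sum_fin_four_bool (g : (Fin 4 → Bool) → ℝ) :
    ∑ x, g x = ∑ a, ∑ b, ∑ c, ∑ d, g ![a, b, c, d] := by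
  simp only [← Fintype.sum_prod_type']
  refine (Fintype.sum_equiv (⟨fun t => ![t.1.1.1, t.1.1.2, t.1.2, t.2],
    fun x => (((x 0, x 1), x 2), x 3), fun _ => rfl, fun x => ?_⟩ :
      ((Bool × Bool) × Bool) × Bool ≃ (Fin 4 → Bool)) _ _ fun _ => rfl).symm
  ext i
  fin_cases i <;> rfl

lemma exists_comp_val {A : Finset (Fin 4)} (y : Vec (fun _ : Fin 4 => Bool) A) :
    ∃ z : Fin 4 → Bool, y = fun i => z i.1 :=
  ⟨fun i => getB y i, by ext i; simp [getB]⟩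

lemma sum_push {α β : Type*} [Fintype α] [Fintype β] (f : α → β) (p : α → ℝ) :
    ∑ b, push f p b = ∑ a, p a := by
  simp only [push]
  exact Finset.sum_fiberwise _ _ _

/-- A mass function taking only the values `0` and `1/4` has entropy two bits. -/
lemma Ent_eq_two {α : Type*} [Fintype α] (q : α → ℝ) (hsum : ∑ x, q x = 1)
    (hq : ∀ x, q x = 0 ∨ q x = 1 / 4) : Ent q = 2 := by
  have hlog : Real.logb 2 (1 / 4) = -2 := by
    rw [show (1 / 4 : ℝ) = 2 ^ (-2 : ℝ) by rw [Real.rpow_neg] <;> norm_num]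
    exact Real.logb_rpow (by norm_num) (by norm_num)
  have h : ∀ x, q x * Real.logb 2 (q x) = q x * -2 := by
    intro x
    rcases hq x with h | h <;> rw [h]
    · simp
    · rw [hlog]
  rw [Ent, Finset.sum_congr rfl fun x _ => h x, ← Finset.sum_mul, hsum]
  norm_num

lemma Ent_Pex {i : Fin 4} (hi : i.1 < 3) : Ent (Pex i) = 1 := by
  have h : Real.logb 2 (1 / 2) = -1 := by
    rw [one_div, Real.logb_inv, Real.logb_self_eq_one (by norm_num)]
  simp only [Ent, Pex, hi, if_true, h, Fintype.sum_bool]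
  norm_num

lemma margF_first_three_eq {p : (Fin 4 → Bool) → ℝ}
    (hp : IsPMF p)
    (hm : ∀ j, margF (X := fun _ => Bool) p (Spairs j) = PSex j)
    (y : Vec (fun _ : Fin 4 => Bool) {0, 1, 2}) :
    margF (X := fun _ => Bool) p {0, 1, 2} y = 0 ∨
      margF (X := fun _ => Bool) p {0, 1, 2} y = 1 / 4 := by
  have key : ∀ (j : Fin 6) (z : Fin 4 → Bool),
      (∑ x : Fin 4 → Bool, if ∀ i ∈ Spairs j, x i = z i then p x else 0) =
        PSex j (fun i => z i.1) := fun j z => by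
    rw [← margF_comp_val, hm j]
  have h0 : ∀ a b, _ := fun a b => key 0 ![a, b, false, false]
  have h1 : ∀ a b, _ := fun a b => key 1 ![a, false, b, false]
  have h2 : ∀ a b, _ := fun a b => key 2 ![false, a, b, false]
  have h3 : ∀ a b, _ := fun a b => key 3 ![a, false, false, b]
  have h4 : ∀ a b, _ := fun a b => key 4 ![false, a, false, b]
  have h5 : ∀ a b, _ := fun a b => key 5 ![false, false, a, b]
  obtain ⟨z, rfl⟩ := exists_comp_val y
  rw [margF_comp_val]
  have hz : ∀ a b c d, 0 ≤ p ![a, b, c, d] := fun a b c d => hp.1 _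
  simp only [sum_fin_four_bool, Fintype.sum_bool, Spairs, PSex, pair14, getB,
    Bool.forall_bool] at h0 h1 h2 h3 h4 h5 hz ⊢
  simp at h0 h1 h2 h3 h4 h5 hz ⊢
  generalize z 0 = a, z 1 = b, z 2 = c
  rcases a <;> rcases b <;> rcases c <;> simp only [Bool.false_eq_true, reduceCtorEq,
    and_true, and_false, and_self, if_true, if_false, add_zero, zero_add] <;>
    first
    | exact Or.inl (by linarith)
    | exact Or.inr (by linarith)

lemma one_le_sum_of_mem_Ra {R : Fin 4 → ℝ}
    (hR : R ∈ Ra (X := fun _ : Fin 4 => Bool) Pex Spairs PSex) : 1 ≤ R 0 + R 1 + R 2 := by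
  have hclosed : IsClosed {R : Fin 4 → ℝ | 1 ≤ R 0 + R 1 + R 2} :=
    isClosed_le continuous_const (by fun_prop)
  have hconvex : Convex ℝ {R : Fin 4 → ℝ | 1 ≤ R 0 + R 1 + R 2} := by
    intro x hx y hy a b ha hb hab
    simp only [Set.mem_ofPred_eq, Pi.add_apply, Pi.smul_apply, smul_eq_mul] at *
    nlinarith
  refine closure_minimal (convexHull_min ?_ hconvex) hclosed hR
  rintro R ⟨p, hp, hm, hJ⟩
  have h := hJ {0, 1, 2} (by simp)
  have hEnt : Ent (margF (X := fun _ => Bool) p {0, 1, 2}) = 2 :=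
    Ent_eq_two _ ((sum_push _ p).trans hp.2) (margF_first_three_eq hp hm)
  rw [hEnt] at h
  simp [Ent_Pex] at h
  simp only [Set.mem_ofPred_eq]
  linarith

theorem Ra_sum_first_three_bounded_below_example :
    (∃ c > (0 : ℝ), ∀ R ∈ Ra (X := fun _ : Fin 4 => Bool) Pex Spairs PSex,
        R 0 + R 1 + R 2 ≥ c) ∧
    ∀ r : ℝ, (![0, 0, 0, r]) ∉ Ra (X := fun _ : Fin 4 => Bool) Pex Spairs PSex := by
  refine ⟨⟨1, one_pos, fun R hR => one_le_sum_of_mem_Ra hR⟩, fun r hr => ?_⟩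
  have h : (1 : ℝ) ≤ 0 + 0 + 0 := one_le_sum_of_mem_Ra hr
  norm_num at h
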